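/- Let q ∈ (0,1), n ≥ 0, and let ν ∈ Sign⁺_n. Then for any integers x ≥ 1 and ℓ ≥ 0: q^{ℓ·h_ν(x)} = Σ_{k=0}^ℓ (−q)^{−k} · binom(ℓ,k)_q · (q;q)_k · Σ_{θ₁ ≥ θ₂ ≥ … ≥ θ_k ≥ x} Q_{(θ₁,…,θ_k)}(ν), where binom(ℓ,k)_q = (q;q)_ℓ/((q;q)_k·(q;q)_{ℓ−k}), the inner sum runs over all k-tuples of integers θ₁ ≥ … ≥ θ_k ≥ x (only finitely many terms are nonzero, since Q_θ(ν) = 0 unless every θ_i is a part of ν), and the k = 0 term is 1. -/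

import Mathlib

open Finset

noncomputable section

/-- The finite q-Pochhammer symbol `(a;q)_m = ∏_{i=0}^{m-1} (1 - a q^i)`. -/
def qPoch {K : Type*} [CommRing K] (a q : K) (m : ℕ) : K :=
  ∏ i ∈ Finset.range m, (1 - a * q ^ i)

/-- Signatures of length `n`: weakly decreasing tuples of nonnegative integers. -/
abbrev Sign (n : ℕ) : Type :=
  {ν : Fin n → ℕ // ∀ i j : Fin n, i ≤ j → ν j ≤ ν i}

/-- The height function `h_ν(x) = #{j : ν_j ≥ x}`. -/
def height {n : ℕ} (ν : Fin n → ℕ) (x : ℕ) : ℕ :=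
  ((Finset.univ : Finset (Fin n)).filter (fun j => x ≤ ν j)).card

/-- The q-correlation observable
`Q_θ(ν) = Σ_{1≤i₁<…<i_k≤n : ν_{i_j}=θ_j} q^{i₁+…+i_k}` (indices are 1-based). -/
def Qobs {K : Type*} [Semiring K] (q : K) {n k : ℕ} (θ : Fin k → ℕ) (ν : Fin n → ℕ) : K :=
  ∑ I ∈ (Finset.powersetCard k (Finset.univ : Finset (Fin n))).attach,
    if ∀ p : Fin k, ν (I.1.orderEmbOfFin (Finset.mem_powersetCard.mp I.2).2 p) = θ p
    then q ^ (∑ i ∈ I.1, ((i : ℕ) + 1)) else 0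

theorem qPoch_self_succ {K : Type*} [CommRing K] (q : K) (m : ℕ) :
    qPoch q q (m + 1) = qPoch q q m * (1 - q ^ (m + 1)) := by
  simp only [qPoch, Finset.prod_range_succ]
  ring

theorem qPoch_self_ne_zero {q : ℝ} (hq : q ∈ Set.Ioo (0 : ℝ) 1) (m : ℕ) :
    qPoch q q m ≠ 0 := by
  refine Finset.prod_ne_zero_iff.mpr fun i _ => ?_
  have h : q ^ (i + 1) < 1 := pow_lt_one₀ hq.1.le hq.2 i.succ_ne_zero
  rw [← pow_succ']
  linarith

/-- Pascal-type recursion for the elementary symmetric polynomials in `q, q², …, q^h`. -/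
theorem sum_powersetCard_range_succ {K : Type*} [CommSemiring K] (q : K) (h k : ℕ) :
    ∑ J ∈ (Finset.range (h + 1)).powersetCard (k + 1), q ^ (∑ j ∈ J, (j + 1)) =
      ∑ J ∈ (Finset.range h).powersetCard (k + 1), q ^ (∑ j ∈ J, (j + 1)) +
        q ^ (h + 1) * ∑ J ∈ (Finset.range h).powersetCard k, q ^ (∑ j ∈ J, (j + 1)) := by
  have hmem : ∀ J ∈ (Finset.range h).powersetCard k, h ∉ J := fun J hJ hh =>
    Finset.notMem_range_self ((Finset.mem_powersetCard.mp hJ).1 hh)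
  rw [Finset.range_add_one, Finset.powersetCard_succ_insert Finset.notMem_range_self,
    Finset.sum_union, Finset.sum_image, Finset.mul_sum]
  · congr 1
    refine Finset.sum_congr rfl fun J hJ => ?_
    rw [Finset.sum_insert (hmem J hJ), pow_add]
  · intro J hJ J' hJ' hJJ'
    rw [← Finset.erase_insert (hmem J hJ), hJJ', Finset.erase_insert (hmem J' hJ')]
  · rw [Finset.disjoint_left]
    intro J hJ hJ'
    obtain ⟨I, -, rfl⟩ := Finset.mem_image.mp hJ'
    exact Finset.notMem_range_self
      ((Finset.mem_powersetCard.mp hJ).1 (Finset.mem_insert_self h I))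

/-- Expansion of `q^{lh}` in the elementary symmetric polynomials of `q, q², …, q^h`. -/
theorem sum_qPoch_mul_sum_powersetCard {q : ℝ} (hq : q ∈ Set.Ioo (0 : ℝ) 1) (h l : ℕ) :
    ∑ k ∈ Finset.range (l + 1), (-q⁻¹) ^ k * (qPoch q q l / qPoch q q (l - k)) *
      ∑ J ∈ (Finset.range h).powersetCard k, q ^ (∑ j ∈ J, (j + 1)) = q ^ (l * h) := by
  have hq0 : q ≠ 0 := hq.1.ne'
  induction h generalizing l with
  | zero =>
    rw [Finset.sum_range_succ']
    have hempty (k : ℕ) : (∅ : Finset ℕ).powersetCard (k + 1) = ∅ :=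
      Finset.powersetCard_eq_empty.mpr k.succ_pos
    simp [div_self (qPoch_self_ne_zero hq l), hempty]
  | succ h ih =>
    cases l with
    | zero => simp [qPoch]
    | succ m =>
      have key := ih (m + 1)
      rw [Finset.sum_range_succ'] at key ⊢
      have hterm : ∀ k ∈ Finset.range (m + 1),
          (-q⁻¹) ^ (k + 1) * (qPoch q q (m + 1) / qPoch q q (m + 1 - (k + 1))) *
            ∑ J ∈ (Finset.range (h + 1)).powersetCard (k + 1), q ^ (∑ j ∈ J, (j + 1)) =
          (-q⁻¹) ^ (k + 1) * (qPoch q q (m + 1) / qPoch q q (m + 1 - (k + 1))) *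
            ∑ J ∈ (Finset.range h).powersetCard (k + 1), q ^ (∑ j ∈ J, (j + 1)) -
          q ^ h * (1 - q ^ (m + 1)) * ((-q⁻¹) ^ k * (qPoch q q m / qPoch q q (m - k)) *
            ∑ J ∈ (Finset.range h).powersetCard k, q ^ (∑ j ∈ J, (j + 1))) := by
        intro k _
        have := qPoch_self_ne_zero hq (m - k)
        rw [sum_powersetCard_range_succ, qPoch_self_succ, Nat.add_sub_add_right,
          pow_succ (-q⁻¹)]
        generalize (-q⁻¹) ^ k = r
        field_simp
        ring
      rw [Finset.sum_congr rfl hterm, Finset.sum_sub_distrib, ← Finset.mul_sum, ih m]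
      simp only [Finset.powersetCard_zero] at key ⊢
      rw [sub_add_eq_add_sub, key]
      ring

theorem eq_range_card_of_isLowerSet {s : Finset ℕ} (hs : IsLowerSet (s : Set ℕ)) :
    s = Finset.range s.card := by
  refine Finset.eq_of_subset_of_card_le (fun a ha => ?_) (by simp)
  have hsub : Finset.range (a + 1) ⊆ s := fun b hb =>
    hs (Nat.lt_succ_iff.mp (Finset.mem_range.mp hb)) ha
  have := Finset.card_le_card hsub
  rw [Finset.card_range] at this
  exact Finset.mem_range.mpr this

/-- The positions of the parts that are at least `x` are the first `h_ν(x)` ones. -/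
theorem map_filter_le_eq_range_height {n : ℕ} (ν : Sign n) (x : ℕ) :
    (Finset.univ.filter (fun j => x ≤ ν.1 j)).map Fin.valEmbedding =
      Finset.range (height ν.1 x) := by
  have hs : IsLowerSet
      (((Finset.univ.filter (fun j => x ≤ ν.1 j)).map Fin.valEmbedding : Finset ℕ) : Set ℕ) := by
    intro a b hba ha
    simp only [Finset.coe_map, Set.mem_image, Finset.mem_coe, Finset.mem_filter,
      Finset.mem_univ, true_and, Fin.valEmbedding_apply] at ha ⊢
    obtain ⟨i, hi, rfl⟩ := ha
    exact ⟨⟨b, hba.trans_lt i.2⟩, hi.trans (ν.2 _ _ hba), rfl⟩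
  have h := eq_range_card_of_isLowerSet hs
  rwa [Finset.card_map] at h

theorem finite_support_Qobs (q : ℝ) {n k : ℕ} (ν : Fin n → ℕ) :
    (Function.support fun θ : Fin k → ℕ => Qobs q θ ν).Finite := by
  refine (Set.Finite.pi' fun _ : Fin k => Set.finite_range ν).subset fun θ hθ p => ?_
  obtain ⟨I, -, hI⟩ := Finset.exists_ne_zero_of_sum_ne_zero hθ
  exact ⟨_, (ite_ne_right_iff.mp hI).1 p⟩

/-- Summing the observables over all signatures with parts at least `x` gives an elementary
symmetric polynomial in `q, q², …, q^{h_ν(x)}`. -/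
theorem hasSum_Qobs (q : ℝ) {n : ℕ} (ν : Sign n) (x k : ℕ) :
    HasSum (fun θ :
        {θ : Fin k → ℕ // (∀ i j : Fin k, i ≤ j → θ j ≤ θ i) ∧ ∀ i, x ≤ θ i} =>
          Qobs q θ.1 ν.1)
      (∑ J ∈ (Finset.range (height ν.1 x)).powersetCard k, q ^ (∑ j ∈ J, (j + 1))) := by
  have hval : ∑ J ∈ (Finset.range (height ν.1 x)).powersetCard k, q ^ (∑ j ∈ J, (j + 1)) =
      ∑ I ∈ (Finset.powersetCard k (Finset.univ : Finset (Fin n))).attach,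
        if ∀ i ∈ I.1, x ≤ ν.1 i then q ^ (∑ i ∈ I.1, ((i : ℕ) + 1)) else 0 := by
    rw [Finset.sum_attach _ fun I : Finset (Fin n) =>
        if ∀ i ∈ I, x ≤ ν.1 i then q ^ (∑ i ∈ I, ((i : ℕ) + 1)) else 0,
      ← Finset.sum_filter, ← map_filter_le_eq_range_height, Finset.powersetCard_map,
      Finset.sum_map]
    refine Finset.sum_congr ?_ fun I _ => ?_
    · ext I
      simp [Finset.mem_powersetCard, Finset.subset_iff, and_comm]
    · simp
  rw [hval]
  refine hasSum_sum fun I _ => ?_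
  have hcard := (Finset.mem_powersetCard.mp I.2).2
  split_ifs with hI
  · let θ₀ : {θ : Fin k → ℕ // (∀ i j : Fin k, i ≤ j → θ j ≤ θ i) ∧ ∀ i, x ≤ θ i} :=
      ⟨fun p => ν.1 (I.1.orderEmbOfFin hcard p),
        fun i j hij => ν.2 _ _ ((I.1.orderEmbOfFin hcard).monotone hij),
        fun p => hI _ (I.1.orderEmbOfFin_mem hcard p)⟩
    convert hasSum_ite_eq θ₀ (q ^ (∑ i ∈ I.1, ((i : ℕ) + 1))) using 3 with θ
    simp only [θ₀, Subtype.ext_iff, funext_iff, eq_comm]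
  · convert hasSum_zero with θ
    refine if_neg fun h => hI fun i hi => ?_
    obtain ⟨p, rfl⟩ : i ∈ Set.range (I.1.orderEmbOfFin hcard) := by
      rwa [Finset.range_orderEmbOfFin]
    exact (θ.2.2 p).trans_eq (h p).symm

/-- Lemma 9.2: expansion of `q^{ℓ·h_ν(x)}` in the q-correlation observables; the inner sum
runs over all signatures `θ₁ ≥ … ≥ θ_k ≥ x` and has finite support. -/
theorem q_moment_from_correlations (q : ℝ) (hq : q ∈ Set.Ioo (0 : ℝ) 1)
    (n : ℕ) (ν : Sign n) (x : ℕ) (hx : 1 ≤ x) (l : ℕ) :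
    (∀ k : ℕ, (Function.support (fun θ :
        {θ : Fin k → ℕ // (∀ i j : Fin k, i ≤ j → θ j ≤ θ i) ∧ ∀ i, x ≤ θ i} =>
          Qobs q θ.1 ν.1)).Finite) ∧
    (q : ℝ) ^ (l * height ν.1 x)
      = ∑ k ∈ Finset.range (l + 1),
          (-q) ^ (-(k : ℤ)) * (qPoch q q l / (qPoch q q k * qPoch q q (l - k))) *
            qPoch q q k *
            ∑' θ : {θ : Fin k → ℕ // (∀ i j : Fin k, i ≤ j → θ j ≤ θ i) ∧ ∀ i, x ≤ θ i},
              Qobs q θ.1 ν.1 := by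
  refine ⟨fun k => (finite_support_Qobs q ν.1).preimage Subtype.val_injective.injOn, ?_⟩
  rw [← sum_qPoch_mul_sum_powersetCard hq]
  refine Finset.sum_congr rfl fun k _ => ?_
  have hk := qPoch_self_ne_zero hq k
  have hlk := qPoch_self_ne_zero hq (l - k)
  have hpow : (-q) ^ (-(k : ℤ)) = (-q⁻¹) ^ k := by
    rw [zpow_neg, zpow_natCast, ← inv_pow, inv_neg]
  rw [(hasSum_Qobs q ν x k).tsum_eq, hpow]
  field_simp

end
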